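/- arXiv:1511.02381 — 2 statements merged into one kernel-verified Lean document; each statement's English description precedes it below -/
import Mathlib

section
/- Suppose g_0(X;Y) = 0 and g_ε(X;Y) = ε·H(Y)/I(X;Y) for 0 ≤ ε ≤ I(X;Y). Then the following are equivalent: (i) Y is uniformly distributed on 𝒴; (ii) D(P_{X|Y}(·|y)‖P_X) takes the same value for all y ∈ 𝒴. -/
open scoped BigOperators

noncomputable section

namespace RatePrivacy

variable {α β γ : Type*}

/-- `p` is a probability mass function on a finite alphabet. -/
def IsPMF [Fintype α] (p : α → ℝ) : Prop := (∀ a, 0 ≤ p a) ∧ ∑ a, p a = 1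

/-- Shannon entropy (in bits) of the distribution `p`. -/
def ent [Fintype α] (p : α → ℝ) : ℝ := ∑ a, -(p a * Real.logb 2 (p a))

/-- First marginal of a joint distribution. -/
def margA [Fintype α] [Fintype β] (p : α × β → ℝ) : α → ℝ := fun a => ∑ b, p (a, b)

/-- Second marginal of a joint distribution. -/
def margB [Fintype α] [Fintype β] (p : α × β → ℝ) : β → ℝ := fun b => ∑ a, p (a, b)

/-- Mutual information (in bits) of a joint distribution `p`:
`I(A;B) = H(A) + H(B) - H(A,B)`. -/
def mi [Fintype α] [Fintype β] (p : α × β → ℝ) : ℝ :=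
  ent (margA p) + ent (margB p) - ent p

/-- `q` is a (row-stochastic) channel. -/
def IsChannel [Fintype γ] (q : β → γ → ℝ) : Prop :=
  (∀ y z, 0 ≤ q y z) ∧ ∀ y, ∑ z, q y z = 1

/-- Joint distribution of `(X, Z)` when `Z` is obtained from `Y` through the channel `q`
(so that `X — Y — Z` is a Markov chain). -/
def jointXZ [Fintype α] [Fintype β] [Fintype γ] (p : α × β → ℝ) (q : β → γ → ℝ) :
    α × γ → ℝ := fun xz => ∑ y, p (xz.1, y) * q y xz.2

/-- Joint distribution of `(Y, Z)` when `Z` is obtained from `Y` through the channel `q`. -/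
def jointYZ [Fintype α] [Fintype β] [Fintype γ] (p : α × β → ℝ) (q : β → γ → ℝ) :
    β × γ → ℝ := fun yz => margB p yz.1 * q yz.1 yz.2

/-- Achievable rates `I(Y;Z)` over all privacy filters `Z` (on finite alphabets, wlog `Fin n`)
with `X — Y — Z` Markov and `I(X;Z) ≤ ε`. -/
def gSet [Fintype α] [Fintype β] (p : α × β → ℝ) (ε : ℝ) : Set ℝ :=
  { r | ∃ (n : ℕ) (q : β → Fin n → ℝ), IsChannel q ∧
        mi (jointXZ p q) ≤ ε ∧ r = mi (jointYZ p q) }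

/-- The rate-privacy function `g_ε(X;Y)` (privacy measured by mutual information). -/
def g [Fintype α] [Fintype β] (p : α × β → ℝ) (ε : ℝ) : ℝ := sSup (gSet p ε)

/-- Values `E[f(A) g(B)]` over all zero-mean unit-variance `f, g`, used to define
the Hirschfeld–Gebelein–Rényi maximal correlation. -/
def corrSet [Fintype α] [Fintype β] (p : α × β → ℝ) : Set ℝ :=
  { r | ∃ (f : α → ℝ) (g : β → ℝ),
      (∑ a, margA p a * f a = 0) ∧ (∑ b, margB p b * g b = 0) ∧
      (∑ a, margA p a * (f a) ^ 2 = 1) ∧ (∑ b, margB p b * (g b) ^ 2 = 1) ∧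
      r = ∑ x : α × β, p x * (f x.1 * g x.2) }

/-- Maximal correlation `ρ_m(A;B)` (equal to `0` when the constraint set is empty,
since `sSup ∅ = 0` in `ℝ`). -/
def rhoM [Fintype α] [Fintype β] (p : α × β → ℝ) : ℝ := sSup (corrSet p)

/-- Achievable rates with maximal-correlation privacy constraint `ρ_m²(X;Z) ≤ ε`. -/
def ghSet [Fintype α] [Fintype β] (p : α × β → ℝ) (ε : ℝ) : Set ℝ :=
  { r | ∃ (n : ℕ) (q : β → Fin n → ℝ), IsChannel q ∧
        (rhoM (jointXZ p q)) ^ 2 ≤ ε ∧ r = mi (jointYZ p q) }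

/-- The rate-privacy function `ĝ_ε(X;Y)` (privacy measured by squared maximal correlation). -/
def gh [Fintype α] [Fintype β] (p : α × β → ℝ) (ε : ℝ) : ℝ := sSup (ghSet p ε)

/-- The Kullback–Leibler divergence (in bits) `D(P_{X|Y}(·|y) ‖ P_X)`. -/
def Dxy [Fintype α] [Fintype β] (p : α × β → ℝ) (y : β) : ℝ :=
  ∑ x, (p (x, y) / margB p y) * Real.logb 2 ((p (x, y) / margB p y) / margA p x)

lemma sub_div_log_le_mul_logb {r s : ℝ} (hr : 0 ≤ r) (hs : 0 ≤ s) (h : 0 < r → 0 < s) :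
    (r - s) / Real.log 2 ≤ r * Real.logb 2 (r / s) := by
  have h2 : 0 < Real.log 2 := Real.log_pos (by norm_num)
  rcases hr.eq_or_lt with rfl | hr
  · simp only [zero_sub, zero_mul]
    exact div_nonpos_of_nonpos_of_nonneg (by linarith) h2.le
  · have hs := h hr
    rw [Real.logb, mul_div_assoc']
    gcongr
    have := Real.one_sub_inv_le_log_of_pos (div_pos hr hs)
    rw [inv_div] at this
    calc r - s = r * (1 - s / r) := by field_simp
      _ ≤ _ := by gcongr

lemma eq_of_mul_logb_eq {r s : ℝ} (hr : 0 ≤ r) (h : 0 < r → 0 < s)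
    (he : r * Real.logb 2 (r / s) = (r - s) / Real.log 2) : r = s := by
  have h2 : 0 < Real.log 2 := Real.log_pos (by norm_num)
  rcases hr.eq_or_lt with rfl | hr
  · simp only [zero_sub, zero_mul] at he
    have := (div_eq_zero_iff.mp he.symm).resolve_right h2.ne'
    linarith
  · have hs := h hr
    by_contra hne
    have hlt := Real.log_lt_sub_one_of_pos (div_pos hs hr)
      (fun h1 => hne ((div_eq_one_iff_eq hr.ne').mp h1).symm)
    rw [Real.logb, mul_div_assoc', div_left_inj' h2.ne'] at he
    have hlog : Real.log (s / r) = - Real.log (r / s) := by rw [← Real.log_inv, inv_div]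
    rw [hlog] at hlt
    have : r * -Real.log (r / s) < r * (s / r - 1) := by gcongr
    have h3 : r * (s / r - 1) = s - r := by field_simp
    linarith

lemma mul_logb_le {r s : ℝ} (hr : 0 ≤ r) (hs : 0 < s) :
    r * Real.logb 2 (r / s) ≤ r * (r / s - 1) / Real.log 2 := by
  have h2 : 0 < Real.log 2 := Real.log_pos (by norm_num)
  rcases hr.eq_or_lt with rfl | hr
  · simp
  · rw [Real.logb, mul_div_assoc']
    gcongr
    exact Real.log_le_sub_one_of_pos (div_pos hr hs)

section Joint

variable [Fintype α] [Fintype β] {r : α × β → ℝ}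

lemma le_margA (h : ∀ x, 0 ≤ r x) (a : α) (b : β) : r (a, b) ≤ margA r a :=
  Finset.single_le_sum (f := fun b => r (a, b)) (fun _ _ => h _) (Finset.mem_univ b)

lemma le_margB (h : ∀ x, 0 ≤ r x) (a : α) (b : β) : r (a, b) ≤ margB r b :=
  Finset.single_le_sum (f := fun a => r (a, b)) (fun _ _ => h _) (Finset.mem_univ a)

lemma sum_margA (hr : IsPMF r) : ∑ a, margA r a = 1 := by
  rw [← hr.2, Fintype.sum_prod_type]; rfl

lemma sum_margB (hr : IsPMF r) : ∑ b, margB r b = 1 := by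
  rw [← hr.2, Fintype.sum_prod_type_right]; rfl

lemma ent_margA (r : α × β → ℝ) :
    ent (margA r) = ∑ a, ∑ b, -(r (a, b) * Real.logb 2 (margA r a)) := by
  simp only [ent, Finset.sum_neg_distrib, ← Finset.sum_mul]; rfl

lemma ent_margB (r : α × β → ℝ) :
    ent (margB r) = ∑ a, ∑ b, -(r (a, b) * Real.logb 2 (margB r b)) := by
  rw [Finset.sum_comm]
  simp only [ent, Finset.sum_neg_distrib, ← Finset.sum_mul]; rfl

lemma mi_eq_sum (h : ∀ x, 0 ≤ r x) :
    mi r = ∑ a, ∑ b, r (a, b) * Real.logb 2 (r (a, b) / (margA r a * margB r b)) := by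
  rw [mi, ent_margA, ent_margB, ent, Fintype.sum_prod_type]
  simp only [← Finset.sum_add_distrib, ← Finset.sum_sub_distrib]
  refine Finset.sum_congr rfl fun a _ => Finset.sum_congr rfl fun b _ => ?_
  rcases (h (a, b)).eq_or_lt with h0 | h0
  · simp [← h0]
  · have hA := h0.trans_le (le_margA h a b)
    have hB := h0.trans_le (le_margB h a b)
    rw [Real.logb_div h0.ne' (mul_pos hA hB).ne', Real.logb_mul hA.ne' hB.ne']
    ring

lemma mi_nonneg (hr : IsPMF r) : 0 ≤ mi r ∧
    (mi r = 0 → ∀ a b, r (a, b) = margA r a * margB r b) := by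
  have h := hr.1
  have hpos : ∀ a b, 0 < r (a, b) → 0 < margA r a * margB r b := fun a b h0 =>
    mul_pos (h0.trans_le (le_margA h a b)) (h0.trans_le (le_margB h a b))
  have hs : ∀ a b, 0 ≤ margA r a * margB r b := fun a b =>
    mul_nonneg (Finset.sum_nonneg fun _ _ => h _) (Finset.sum_nonneg fun _ _ => h _)
  have hterm : ∀ a b, 0 ≤ r (a, b) * Real.logb 2 (r (a, b) / (margA r a * margB r b)) -
      (r (a, b) - margA r a * margB r b) / Real.log 2 := fun a b =>
    sub_nonneg.mpr (sub_div_log_le_mul_logb (h _) (hs a b) (hpos a b))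
  have hsum : mi r = ∑ a, ∑ b, (r (a, b) *
      Real.logb 2 (r (a, b) / (margA r a * margB r b)) -
      (r (a, b) - margA r a * margB r b) / Real.log 2) := by
    simp only [Finset.sum_sub_distrib, ← Finset.sum_div, ← Finset.mul_sum, ← Finset.sum_mul]
    rw [← mi_eq_sum h, ← Fintype.sum_prod_type, hr.2, sum_margB hr, sum_margA hr]
    simp
  rw [hsum]
  refine ⟨Finset.sum_nonneg fun a _ => Finset.sum_nonneg fun b _ => hterm a b,
    fun h0 a b => ?_⟩
  have h1 := (Finset.sum_eq_zero_iff_of_nonneg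
    (fun a _ => Finset.sum_nonneg fun b _ => hterm a b)).mp h0 a (Finset.mem_univ a)
  have h2 := (Finset.sum_eq_zero_iff_of_nonneg (fun b _ => hterm a b)).mp h1 b
    (Finset.mem_univ b)
  exact eq_of_mul_logb_eq (h _) (hpos a b) (sub_eq_zero.mp h2)

lemma mi_le_ent_margA (h : ∀ x, 0 ≤ r x) : mi r ≤ ent (margA r) := by
  rw [mi, ent_margB, ent.eq_1 r, Fintype.sum_prod_type, add_sub_assoc, add_le_iff_nonpos_right,
    sub_nonpos]
  refine Finset.sum_le_sum fun a _ => Finset.sum_le_sum fun b _ => ?_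
  rcases (h (a, b)).eq_or_lt with h0 | h0
  · simp [← h0]
  · gcongr
    · norm_num
    · exact le_margB h a b

lemma mi_le_ent_margB (h : ∀ x, 0 ≤ r x) : mi r ≤ ent (margB r) := by
  rw [mi, ent_margA, ent.eq_1 r, Fintype.sum_prod_type, add_comm, add_sub_assoc,
    add_le_iff_nonpos_right, sub_nonpos]
  refine Finset.sum_le_sum fun a _ => Finset.sum_le_sum fun b _ => ?_
  rcases (h (a, b)).eq_or_lt with h0 | h0
  · simp [← h0]
  · gcongr
    · norm_num
    · exact le_margA h a b

lemma margB_mul_Dxy {y : β} (hy : margB r y ≠ 0) :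
    margB r y * Dxy r y =
      ∑ x, r (x, y) * Real.logb 2 (r (x, y) / (margA r x * margB r y)) := by
  rw [Dxy, Finset.mul_sum]
  refine Finset.sum_congr rfl fun x _ => ?_
  rw [← mul_assoc, mul_div_cancel₀ _ hy, div_div, mul_comm (margB r y)]

lemma mi_eq_sum_Dxy (h : ∀ x, 0 ≤ r x) (hy : ∀ y, margB r y ≠ 0) :
    mi r = ∑ y, margB r y * Dxy r y := by
  rw [mi_eq_sum h, Finset.sum_comm]
  exact Finset.sum_congr rfl fun y _ => (margB_mul_Dxy (hy y)).symm

end Joint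

open Classical in
/-- The binary channel that outputs `1` with probability `δ` on input `y₀`, and `0` otherwise. -/
def flagChannel (y₀ : β) (δ : ℝ) : β → Fin 2 → ℝ :=
  fun y => ![1 - if y = y₀ then δ else 0, if y = y₀ then δ else 0]

lemma isChannel_flagChannel (y₀ : β) {δ : ℝ} (h0 : 0 ≤ δ) (h1 : δ ≤ 1) :
    IsChannel (flagChannel y₀ δ) := by
  refine ⟨fun y z => ?_, fun y => by simp [flagChannel]⟩
  fin_cases z <;> simp only [flagChannel] <;> split_ifs <;> simp [h0, h1]

section Channel

variable [Fintype α] [Fintype β] {p : α × β → ℝ}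

lemma isPMF_jointXZ [Fintype γ] (hp : IsPMF p) {q : β → γ → ℝ} (hq : IsChannel q) :
    IsPMF (jointXZ p q) := by
  refine ⟨fun x => Finset.sum_nonneg fun y _ => mul_nonneg (hp.1 _) (hq.1 _ _), ?_⟩
  rw [Fintype.sum_prod_type, ← hp.2, Fintype.sum_prod_type]
  refine Finset.sum_congr rfl fun a _ => ?_
  simp only [jointXZ]
  rw [Finset.sum_comm]
  simp only [← Finset.mul_sum, hq.2, mul_one]

lemma margA_jointXZ [Fintype γ] {q : β → γ → ℝ} (hq : IsChannel q) :
    margA (jointXZ p q) = margA p := by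
  funext a
  simp only [margA, jointXZ]
  rw [Finset.sum_comm]
  simp only [← Finset.mul_sum, hq.2, mul_one]

lemma margA_jointYZ [Fintype γ] {q : β → γ → ℝ} (hq : IsChannel q) :
    margA (jointYZ p q) = margB p := by
  funext b
  simp only [margA, jointYZ, ← Finset.mul_sum, hq.2, mul_one]

lemma jointXZ_flagChannel_one (y₀ : β) (δ : ℝ) (x : α) :
    jointXZ p (flagChannel y₀ δ) (x, 1) = δ * p (x, y₀) := by
  classical
  simp [jointXZ, flagChannel, mul_comm]

lemma jointXZ_flagChannel_zero (y₀ : β) (δ : ℝ) (x : α) :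
    jointXZ p (flagChannel y₀ δ) (x, 0) = margA p x - δ * p (x, y₀) := by
  classical
  simp [jointXZ, flagChannel, mul_sub, margA, mul_comm δ]

lemma margB_jointXZ_flagChannel_one (y₀ : β) (δ : ℝ) :
    margB (jointXZ p (flagChannel y₀ δ)) 1 = δ * margB p y₀ := by
  simp only [margB, jointXZ_flagChannel_one, Finset.mul_sum]

lemma margB_jointXZ_flagChannel_zero (hp : IsPMF p) (y₀ : β) (δ : ℝ) :
    margB (jointXZ p (flagChannel y₀ δ)) 0 = 1 - δ * margB p y₀ := by
  simp only [margB, jointXZ_flagChannel_zero, Finset.mul_sum, Finset.sum_sub_distrib,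
    sum_margA hp]

lemma mi_jointXZ_flagChannel (hp : IsPMF p) {y₀ : β} (hy : 0 < margB p y₀) {δ : ℝ}
    (h0 : 0 < δ) (h1 : δ < 1) :
    mi (jointXZ p (flagChannel y₀ δ)) = δ * (margB p y₀ * Dxy p y₀) +
      ∑ x, (margA p x - δ * p (x, y₀)) * Real.logb 2 ((margA p x - δ * p (x, y₀)) /
        (margA p x * (1 - δ * margB p y₀))) := by
  have hq := isChannel_flagChannel y₀ h0.le h1.le
  rw [mi_eq_sum (isPMF_jointXZ hp hq).1, margB_mul_Dxy hy.ne', Finset.mul_sum,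
    ← Finset.sum_add_distrib]
  refine Finset.sum_congr rfl fun x _ => ?_
  rw [Fin.sum_univ_two, margA_jointXZ hq, margB_jointXZ_flagChannel_one,
    margB_jointXZ_flagChannel_zero hp, jointXZ_flagChannel_one, jointXZ_flagChannel_zero,
    add_comm, mul_left_comm (margA p x) δ, mul_div_mul_left _ _ h0.ne', mul_assoc δ]

lemma margB_le_one (hp : IsPMF p) (y : β) : margB p y ≤ 1 := by
  rw [← sum_margB hp]
  exact Finset.single_le_sum (f := margB p) (fun _ _ => Finset.sum_nonneg fun _ _ => hp.1 _)
    (Finset.mem_univ y)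

lemma le_mi_jointXZ_flagChannel (hp : IsPMF p) {y₀ : β} (hy : 0 < margB p y₀) {δ : ℝ}
    (h0 : 0 < δ) (h1 : δ < 1) :
    δ * (margB p y₀ * Dxy p y₀) ≤ mi (jointXZ p (flagChannel y₀ δ)) := by
  rw [mi_jointXZ_flagChannel hp hy h0 h1, le_add_iff_nonneg_right]
  have hm := margB_le_one hp y₀
  have hu : 0 < 1 - δ * margB p y₀ := by nlinarith
  have hle := fun x => le_margA hp.1 x y₀
  have hsum : ∑ x, (margA p x - δ * p (x, y₀) - margA p x * (1 - δ * margB p y₀)) /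
      Real.log 2 = 0 := by
    rw [← Finset.sum_div, Finset.sum_sub_distrib, Finset.sum_sub_distrib, ← Finset.mul_sum,
      ← Finset.sum_mul, sum_margA hp]
    simp [margB]
  rw [← hsum]
  refine Finset.sum_le_sum fun x _ => ?_
  have hb := hp.1 (x, y₀)
  have ha := hb.trans (hle x)
  refine sub_div_log_le_mul_logb (by nlinarith [hle x]) (mul_nonneg ha hu.le) fun hr =>
    mul_pos ?_ hu
  nlinarith

lemma mi_jointXZ_flagChannel_le (hp : IsPMF p) {y₀ : β} (hy : 0 < margB p y₀) {δ : ℝ}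
    (h0 : 0 < δ) (h1 : δ < 1) :
    mi (jointXZ p (flagChannel y₀ δ)) ≤
      δ * (margB p y₀ * Dxy p y₀) + δ ^ 2 * margB p y₀ / Real.log 2 := by
  rw [mi_jointXZ_flagChannel hp hy h0 h1, add_le_add_iff_left]
  have h2 : 0 < Real.log 2 := Real.log_pos (by norm_num)
  have hm := margB_le_one hp y₀
  have hu : 0 < 1 - δ * margB p y₀ := by nlinarith
  set m := margB p y₀ with hmdef
  have hle := fun x => le_margA hp.1 x y₀
  calc _ ≤ ∑ x, ((margA p x - 2 * δ * p (x, y₀) + δ ^ 2 * p (x, y₀)) / (1 - δ * m) -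
        (margA p x - δ * p (x, y₀))) / Real.log 2 := Finset.sum_le_sum fun x _ => ?_
    _ = ((1 - 2 * δ * m + δ ^ 2 * m) / (1 - δ * m) - (1 - δ * m)) / Real.log 2 := ?_
    _ ≤ _ := ?_
  · have hb := hp.1 (x, y₀)
    have hab := hle x
    generalize p (x, y₀) = b at *
    generalize margA p x = a at *
    rcases (hb.trans hab).eq_or_lt with rfl | ha
    · obtain rfl : b = 0 := le_antisymm hab hb
      simp
    · refine (mul_logb_le (by nlinarith) (mul_pos ha hu)).trans ?_
      gcongr
      have hsq : (a - δ * b) ^ 2 / a ≤ a - 2 * δ * b + δ ^ 2 * b := by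
        rw [div_le_iff₀ ha]
        nlinarith [mul_nonneg (sq_nonneg δ) (mul_nonneg hb (sub_nonneg.mpr hab))]
      calc (a - δ * b) * ((a - δ * b) / (a * (1 - δ * m)) - 1)
          = (a - δ * b) ^ 2 / a / (1 - δ * m) - (a - δ * b) := by field_simp
        _ ≤ _ := by gcongr
  · rw [← Finset.sum_div, Finset.sum_sub_distrib, ← Finset.sum_div, Finset.sum_add_distrib,
      Finset.sum_sub_distrib, Finset.sum_sub_distrib, ← Finset.mul_sum, ← Finset.mul_sum,
      ← Finset.mul_sum, sum_margA hp, hmdef]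
    rfl
  · gcongr
    rw [sub_le_iff_le_add, div_le_iff₀ hu]
    have : 0 ≤ δ ^ 2 * m ^ 2 * (1 - δ) :=
      mul_nonneg (by positivity) (by linarith)
    nlinarith

end Channel

open Classical in
/-- The joint distribution of `(A, A)` where `A` has distribution `m`. -/
def diagJoint (m : β → ℝ) : β × β → ℝ := fun y => if y.1 = y.2 then m y.2 else 0

section Diag

variable [Fintype β] {m : β → ℝ}

lemma margA_diagJoint : margA (diagJoint m) = m := by
  classical
  funext y; simp [margA, diagJoint]

lemma margB_diagJoint : margB (diagJoint m) = m := by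
  classical
  funext y; simp [margB, diagJoint]

lemma isPMF_diagJoint (hm : IsPMF m) : IsPMF (diagJoint m) := by
  refine ⟨fun y => ?_, ?_⟩
  · unfold diagJoint
    split_ifs
    exacts [hm.1 _, le_rfl]
  · rw [Fintype.sum_prod_type, ← hm.2]
    exact Finset.sum_congr rfl fun y _ => congrFun margA_diagJoint y

lemma Dxy_diagJoint {y : β} (hy : m y ≠ 0) : Dxy (diagJoint m) y = -Real.logb 2 (m y) := by
  rw [Dxy, Finset.sum_eq_single y]
  · simp [diagJoint, margA_diagJoint, margB_diagJoint, hy]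
  · intro x _ hx
    simp [diagJoint, hx]
  · simp

lemma jointXZ_diagJoint [Fintype α] [Fintype γ] (p : α × β → ℝ) (q : β → γ → ℝ) :
    jointXZ (diagJoint (margB p)) q = jointYZ p q := by
  classical
  funext y
  simp [jointXZ, jointYZ, diagJoint]

end Diag

lemma mi_jointYZ_le_g [Fintype α] [Fintype β] {p : α × β → ℝ} (hp : IsPMF p) {ε : ℝ} {n : ℕ}
    {q : β → Fin n → ℝ} (hq : IsChannel q) (h : mi (jointXZ p q) ≤ ε) :
    mi (jointYZ p q) ≤ g p ε := by
  refine le_csSup ⟨ent (margB p), ?_⟩ ⟨n, q, hq, h, rfl⟩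
  rintro _ ⟨k, w, hw, -, rfl⟩
  rw [← margA_jointYZ (p := p) hw]
  exact mi_le_ent_margA fun y =>
    mul_nonneg (Finset.sum_nonneg fun _ _ => hp.1 _) (hw.1 _ _)

lemma mi_mul_neg_logb_le [Fintype α] [Fintype β] {p : α × β → ℝ} (hp : IsPMF p)
    (hI : 0 < mi p) (hlin : ∀ ε : ℝ, 0 ≤ ε → ε ≤ mi p → g p ε = ε * ent (margB p) / mi p)
    {y : β} (hy : 0 < margB p y) :
    mi p * -Real.logb 2 (margB p y) ≤ ent (margB p) * Dxy p y := by
  have hmB : IsPMF (margB p) := ⟨fun _ => Finset.sum_nonneg fun _ _ => hp.1 _, sum_margB hp⟩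
  set m := margB p y with hm
  set U : ℝ → ℝ := fun δ => δ * (m * Dxy p y) + δ ^ 2 * m / Real.log 2 with hU
  have hUlt : ∀ᶠ δ in nhdsWithin (0 : ℝ) (Set.Ioi 0), U δ < mi p := by
    have hc : Continuous U := by fun_prop
    have ht : Filter.Tendsto U (nhdsWithin 0 (Set.Ioi 0)) (nhds (U 0)) :=
      hc.continuousAt.tendsto.mono_left nhdsWithin_le_nhds
    exact ht.eventually_lt_const (by simpa [hU] using hI)
  have hev : ∀ᶠ δ in nhdsWithin (0 : ℝ) (Set.Ioi 0),
      mi p * (m * -Real.logb 2 m) ≤ (m * Dxy p y + δ * m / Real.log 2) * ent (margB p) := by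
    filter_upwards [hUlt, Ioo_mem_nhdsGT (zero_lt_one' ℝ)] with δ hδ hδ01
    obtain ⟨h0, h1⟩ := hδ01
    have hq := isChannel_flagChannel y h0.le h1.le
    have hXZ : mi (jointXZ p (flagChannel y δ)) ≤ U δ := mi_jointXZ_flagChannel_le hp hy h0 h1
    have hlow := le_mi_jointXZ_flagChannel (isPMF_diagJoint hmB) (y₀ := y)
      (by rwa [margB_diagJoint]) h0 h1
    rw [jointXZ_diagJoint, margB_diagJoint, Dxy_diagJoint (m := margB p) hy.ne'] at hlow
    have hle := hlow.trans (mi_jointYZ_le_g hp hq hXZ)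
    rw [hlin _ ((mi_nonneg (isPMF_jointXZ hp hq)).1.trans hXZ) hδ.le, le_div_iff₀ hI] at hle
    refine le_of_mul_le_mul_left ?_ h0
    calc δ * (mi p * (m * -Real.logb 2 m)) = δ * (m * -Real.logb 2 m) * mi p := by ring
      _ ≤ U δ * ent (margB p) := hle
      _ = _ := by simp only [hU]; ring
  have hlim : Filter.Tendsto
      (fun δ : ℝ => (m * Dxy p y + δ * m / Real.log 2) * ent (margB p))
      (nhdsWithin 0 (Set.Ioi 0)) (nhds ((m * Dxy p y + 0 * m / Real.log 2) * ent (margB p))) :=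
    Filter.Tendsto.mono_left (Continuous.tendsto (by fun_prop) 0) nhdsWithin_le_nhds
  have := ge_of_tendsto hlim hev
  rw [zero_mul, zero_div, add_zero] at this
  refine le_of_mul_le_mul_left ?_ hy
  linarith

/-- If `g_0(X;Y) = 0` and `g_ε(X;Y) = ε·H(Y)/I(X;Y)` for
`0 ≤ ε ≤ I(X;Y)`, then `Y` is uniformly distributed iff `D(P_{X|Y}(·|y)‖P_X)` takes the
same value for all `y`. -/
theorem stmt13 {𝓧 𝓨 : Type*} [Fintype 𝓧] [Fintype 𝓨]
    (p : 𝓧 × 𝓨 → ℝ) (hp : IsPMF p)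
    (hYpos : ∀ y, 0 < margB p y)
    (hdep : ¬ ∀ x y, p (x, y) = margA p x * margB p y)
    (hg0 : g p 0 = 0)
    (hlin : ∀ ε : ℝ, 0 ≤ ε → ε ≤ mi p → g p ε = ε * ent (margB p) / mi p) :
    (∀ y : 𝓨, margB p y = 1 / (Fintype.card 𝓨 : ℝ)) ↔
      (∀ y y' : 𝓨, Dxy p y = Dxy p y') := by
  have hI : 0 < mi p :=
    lt_of_le_of_ne (mi_nonneg hp).1 fun h => hdep ((mi_nonneg hp).2 h.symm)
  have hH : 0 < ent (margB p) := hI.trans_le (mi_le_ent_margB hp.1)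
  have hle := fun y => mi_mul_neg_logb_le hp hI hlin (hYpos y)
  have hsum : ∑ y, margB p y * (ent (margB p) * Dxy p y -
      mi p * -Real.logb 2 (margB p y)) = 0 := by
    have h1 : ∑ y, margB p y * (ent (margB p) * Dxy p y) = ent (margB p) * mi p := by
      rw [mi_eq_sum_Dxy hp.1 fun y => (hYpos y).ne', Finset.mul_sum]
      exact Finset.sum_congr rfl fun y _ => by ring
    have h2 : ∑ y, margB p y * (mi p * -Real.logb 2 (margB p y)) =
        ent (margB p) * mi p := by
      rw [ent, Finset.sum_mul]
      exact Finset.sum_congr rfl fun y _ => by ring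
    simp only [mul_sub (margB p _), Finset.sum_sub_distrib, h1, h2, sub_self]
  have heq : ∀ y, ent (margB p) * Dxy p y = mi p * -Real.logb 2 (margB p y) := fun y => by
    have h := (Finset.sum_eq_zero_iff_of_nonneg fun y _ =>
      mul_nonneg (hYpos y).le (sub_nonneg.mpr (hle y))).mp hsum y (Finset.mem_univ y)
    exact sub_eq_zero.mp ((mul_eq_zero.mp h).resolve_left (hYpos y).ne')
  constructor
  · intro hu y y'
    refine mul_left_cancel₀ hH.ne' ?_
    rw [heq, heq, hu, hu]
  · intro hD y
    have hconst : ∀ y', margB p y' = margB p y := fun y' => by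
      have h := heq y'
      rw [hD y' y, heq y] at h
      exact (Real.logb_injOn_pos one_lt_two (hYpos y) (hYpos y')
        (neg_injective (mul_left_cancel₀ hI.ne' h))).symm
    have h1 := sum_margB hp
    rw [Finset.sum_congr rfl fun y' _ => hconst y', Finset.sum_const, nsmul_eq_mul,
      Finset.card_univ] at h1
    exact eq_one_div_of_mul_eq_one_right h1

end RatePrivacy
end
end

section
/- If the reverse channel P_{X|Y} is binary-input symmetric-output (BISO), then for every ε ∈ [0, I(X;Y)], ε·H(Y)/I(X;Y) ≤ g_ε(X;Y) ≤ H(Y) − (I(X;Y) − ε)/C(P_{X|Y}), where C(P_{X|Y}) is the capacity of the channel P_{X|Y}. -/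
open scoped BigOperators

noncomputable section

namespace RatePrivacy

variable {α β γ : Type*}

/-- The alphabet `𝒳 = {0, ±1, …, ±k}` of a BISO channel output. -/
abbrev Xk (k : ℕ) : Type := {x : ℤ // x ∈ Finset.Icc (-(k : ℤ)) (k : ℤ)}

/-- Negation on the alphabet `{0, ±1, …, ±k}`. -/
def negXk {k : ℕ} (x : Xk k) : Xk k :=
  ⟨-x.1, by
    have := x.2
    simp only [Finset.mem_Icc] at this ⊢
    omega⟩

/-- The reverse channel `P_{X|Y}` of the joint distribution `p` is binary-input
symmetric-output (BISO): `P_{X|Y}(x|1) = P_{X|Y}(−x|0)` for all `x`.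
(Here `Y = true` plays the role of `1` and `Y = false` that of `0`.) -/
def IsBISO {k : ℕ} (p : Xk k × Bool → ℝ) : Prop :=
  ∀ x : Xk k, p (x, true) / margB p true = p (negXk x, false) / margB p false

/-- The capacity of the reverse channel `P_{X|Y}` (maximal mutual information over input
distributions `w` on `{0,1}`). -/
def capacity {k : ℕ} (p : Xk k × Bool → ℝ) : ℝ :=
  sSup { r | ∃ w : Bool → ℝ, (∀ b, 0 ≤ w b) ∧ (∑ b, w b = 1) ∧
      r = mi (fun xb : Xk k × Bool => (p (xb.1, xb.2) / margB p xb.2) * w xb.2) }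

/-- Chebyshev's sum inequality with nonnegative weights. -/
theorem weighted_chebyshev (s : Finset ℕ) (c a b : ℕ → ℝ) (hc : ∀ i, 0 ≤ c i)
    (ha : Antitone a) (hb : Antitone b) :
    (∑ i ∈ s, c i * a i) * (∑ i ∈ s, c i * b i) ≤
      (∑ i ∈ s, c i) * ∑ i ∈ s, c i * (a i * b i) := by
  have key : 0 ≤ ∑ i ∈ s, ∑ j ∈ s, c i * c j * ((a i - a j) * (b i - b j)) := by
    refine Finset.sum_nonneg fun i _ => Finset.sum_nonneg fun j _ =>
      mul_nonneg (mul_nonneg (hc i) (hc j)) ?_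
    rcases le_total i j with h | h
    · exact mul_nonneg (sub_nonneg.2 (ha h)) (sub_nonneg.2 (hb h))
    · exact mul_nonneg_of_nonpos_of_nonpos (sub_nonpos.2 (ha h)) (sub_nonpos.2 (hb h))
  have h2 : ∑ i ∈ s, ∑ j ∈ s, c i * c j * ((a i - a j) * (b i - b j)) =
      2 * ((∑ i ∈ s, c i) * ∑ i ∈ s, c i * (a i * b i)) -
        2 * ((∑ i ∈ s, c i * a i) * (∑ i ∈ s, c i * b i)) := by
    have e : ∀ i j, c i * c j * ((a i - a j) * (b i - b j)) =
        (c i * (a i * b i)) * c j + c i * (c j * (a j * b j))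
          - ((c i * a i) * (c j * b j) + (c i * b i) * (c j * a j)) := fun i j => by ring
    simp only [e, Finset.sum_sub_distrib, Finset.sum_add_distrib, ← Finset.sum_mul_sum]
    ring
  linarith

/-- The deficit of the binary entropy from its maximum `log 2`, as a power series in the bias. -/
theorem hasSum_log_two_sub_binEntropy {u : ℝ} (hu : |u| < 1) :
    HasSum (fun n : ℕ => (1 / (2 * (n : ℝ) + 1) - 1 / (2 * (n : ℝ) + 2)) * (u ^ 2) ^ (n + 1))
      (Real.log 2 - Real.binEntropy ((1 + u) / 2)) := by
  obtain ⟨hl, hr⟩ := abs_lt.1 hu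
  have hu2 : |u ^ 2| < 1 := by rw [abs_pow]; exact pow_lt_one₀ (abs_nonneg u) hu two_ne_zero
  have h1 := ((Real.hasSum_log_sub_log_of_abs_lt_one hu).mul_left (u / 2)).sub
    ((Real.hasSum_pow_div_log_of_abs_lt_one hu2).mul_left (1 / 2))
  have hval : u / 2 * (Real.log (1 + u) - Real.log (1 - u)) - 1 / 2 * -Real.log (1 - u ^ 2) =
      Real.log 2 - Real.binEntropy ((1 + u) / 2) := by
    rw [Real.binEntropy_eq_negMulLog_add_negMulLog_one_sub,
      show 1 - (1 + u) / 2 = (1 - u) / 2 by ring, show 1 - u ^ 2 = (1 + u) * (1 - u) by ring,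
      Real.log_mul (by linarith) (by linarith)]
    simp only [Real.negMulLog]
    rw [Real.log_div (by linarith) two_ne_zero, Real.log_div (by linarith) two_ne_zero]
    ring
  rw [hval] at h1
  refine h1.congr_fun ?_
  intro n
  have : (n : ℝ) + 1 ≠ 0 := by positivity
  have : 2 * (n : ℝ) + 1 ≠ 0 := by positivity
  field_simp
  ring

theorem sum_range_le_log_two (N : ℕ) :
    ∑ n ∈ Finset.range N, (1 / (2 * (n : ℝ) + 1) - 1 / (2 * (n : ℝ) + 2)) ≤ Real.log 2 := by
  have hcont : Filter.Tendsto (fun u : ℝ => ∑ n ∈ Finset.range N,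
      (1 / (2 * (n : ℝ) + 1) - 1 / (2 * (n : ℝ) + 2)) * (u ^ 2) ^ (n + 1)) (nhdsWithin 1 (Set.Iio 1))
      (nhds (∑ n ∈ Finset.range N,
      (1 / (2 * (n : ℝ) + 1) - 1 / (2 * (n : ℝ) + 2)) * ((1 : ℝ) ^ 2) ^ (n + 1))) := by
    apply Filter.Tendsto.mono_left _ nhdsWithin_le_nhds
    apply Continuous.tendsto (f := fun u : ℝ => ∑ n ∈ Finset.range N,
      (1 / (2 * (n : ℝ) + 1) - 1 / (2 * (n : ℝ) + 2)) * (u ^ 2) ^ (n + 1))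
    fun_prop
  simp only [one_pow, mul_one] at hcont
  refine le_of_tendsto hcont ?_
  filter_upwards [Ioo_mem_nhdsLT (show (0 : ℝ) < 1 by norm_num)] with u hu
  refine (sum_le_hasSum _ ?_ (hasSum_log_two_sub_binEntropy
    (abs_lt.2 ⟨by linarith [hu.1], hu.2⟩))).trans ?_
  · intro n _
    have : 1 / (2 * (n : ℝ) + 2) ≤ 1 / (2 * (n : ℝ) + 1) :=
      one_div_le_one_div_of_le (by positivity) (by linarith)
    exact mul_nonneg (sub_nonneg.2 this) (by positivity)
  · have := Real.binEntropy_nonneg (p := (1 + u) / 2) (by linarith [hu.1]) (by linarith [hu.2])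
    linarith

theorem log_two_sub_binEntropy_mul_le_of_abs_lt {u v : ℝ} (hu : |u| < 1) (hv : |v| < 1) :
    (Real.log 2 - Real.binEntropy ((1 + u) / 2)) * (Real.log 2 - Real.binEntropy ((1 + v) / 2)) ≤
      Real.log 2 * (Real.log 2 - Real.binEntropy ((1 + u * v) / 2)) := by
  have huv : |u * v| < 1 := by
    rw [abs_mul]; exact mul_lt_one_of_nonneg_of_lt_one_left (abs_nonneg u) hu hv.le
  have hc : ∀ n : ℕ, 0 ≤ 1 / (2 * (n : ℝ) + 1) - 1 / (2 * (n : ℝ) + 2) := fun n =>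
    sub_nonneg.2 (one_div_le_one_div_of_le (by positivity) (by linarith))
  have hanti : ∀ {w : ℝ}, |w| < 1 → Antitone fun n : ℕ => (w ^ 2) ^ (n + 1) := fun {w} hw =>
    (pow_right_anti₀ (sq_nonneg w) ((sq_le_one_iff_abs_le_one w).2 hw.le)).comp_monotone
      fun a b h => Nat.succ_le_succ h
  refine le_of_tendsto_of_tendsto'
    ((hasSum_log_two_sub_binEntropy hu).tendsto_sum_nat.mul
      (hasSum_log_two_sub_binEntropy hv).tendsto_sum_nat)
    ((hasSum_log_two_sub_binEntropy huv).tendsto_sum_nat.const_mul (Real.log 2)) fun N => ?_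
  refine (weighted_chebyshev _ _ _ _ hc (hanti hu) (hanti hv)).trans ?_
  simp only [mul_pow]
  exact mul_le_mul_of_nonneg_right (sum_range_le_log_two N)
    (Finset.sum_nonneg fun n _ => mul_nonneg (hc n) (by positivity))

/-- A form of Mrs. Gerber's lemma: concatenating binary symmetric channels with crossover
probabilities `w` and `c`, the capacities are supermultiplicative. -/
theorem log_two_sub_binEntropy_mul_le {w c : ℝ} (hw : w ∈ Set.Icc (0 : ℝ) 1)
    (hc : c ∈ Set.Icc (0 : ℝ) 1) :
    (Real.log 2 - Real.binEntropy w) * (Real.log 2 - Real.binEntropy c) ≤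
      Real.log 2 * (Real.log 2 - Real.binEntropy (w * c + (1 - w) * (1 - c))) := by
  rcases eq_or_lt_of_le hw.1 with rfl | hw0
  · simp
  rcases eq_or_lt_of_le hw.2 with rfl | hw1
  · simp
  rcases eq_or_lt_of_le hc.1 with rfl | hc0
  · simp [mul_comm]
  rcases eq_or_lt_of_le hc.2 with rfl | hc1
  · simp [mul_comm]
  have := log_two_sub_binEntropy_mul_le_of_abs_lt (u := 2 * w - 1) (v := 2 * c - 1)
    (abs_lt.2 ⟨by linarith, by linarith⟩) (abs_lt.2 ⟨by linarith, by linarith⟩)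
  convert this using 4 <;> ring

theorem negMulLog_mul_add_negMulLog_mul_one_sub (m x : ℝ) :
    Real.negMulLog (m * x) + Real.negMulLog (m * (1 - x)) =
      m * Real.binEntropy x + Real.negMulLog m := by
  rw [Real.negMulLog_mul, Real.negMulLog_mul,
    Real.binEntropy_eq_negMulLog_add_negMulLog_one_sub]
  ring

theorem exists_eq_mul_of_nonneg {a b : ℝ} (ha : 0 ≤ a) (hb : 0 ≤ b) :
    ∃ m w : ℝ, 0 ≤ m ∧ w ∈ Set.Icc (0 : ℝ) 1 ∧ a = m * w ∧ b = m * (1 - w) := by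
  rcases (add_nonneg ha hb).eq_or_lt with h | h
  · exact ⟨0, 0, le_rfl, by simp, by linarith, by linarith⟩
  · refine ⟨a + b, a / (a + b), h.le, ⟨by positivity, (div_le_one h).2 (by linarith)⟩, ?_, ?_⟩
    · field_simp
    · field_simp
      ring

theorem negMulLog_mix_le {a b s t : ℝ} (ha : 0 ≤ a) (hb : 0 ≤ b) (hs : 0 ≤ s) (ht : 0 ≤ t) :
    (Real.negMulLog (a * s + b * t) + Real.negMulLog (a * t + b * s)
        - (a + b) * (Real.negMulLog s + Real.negMulLog t) - (s + t) * Real.negMulLog (a + b))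
        * Real.log 2 ≤
      (Real.negMulLog a + Real.negMulLog b - Real.negMulLog (a + b)) *
        (Real.negMulLog (1 / 2 * s + 1 / 2 * t) + Real.negMulLog (1 / 2 * t + 1 / 2 * s)
          - (Real.negMulLog s + Real.negMulLog t)) := by
  obtain ⟨M, w, hM, hw, rfl, rfl⟩ := exists_eq_mul_of_nonneg ha hb
  obtain ⟨m, c, hm, hc, rfl, rfl⟩ := exists_eq_mul_of_nonneg hs ht
  rw [show M * w * (m * c) + M * (1 - w) * (m * (1 - c)) =
      M * m * (w * c + (1 - w) * (1 - c)) by ring,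
    show M * w * (m * (1 - c)) + M * (1 - w) * (m * c) =
      M * m * (1 - (w * c + (1 - w) * (1 - c))) by ring,
    show M * w + M * (1 - w) = M by ring, show m * c + m * (1 - c) = m by ring,
    show 1 / 2 * (m * c) + 1 / 2 * (m * (1 - c)) = m * 2⁻¹ by ring,
    show 1 / 2 * (m * (1 - c)) + 1 / 2 * (m * c) = m * (1 - 2⁻¹) by ring]
  simp only [negMulLog_mul_add_negMulLog_mul_one_sub, Real.binEntropy_two_inv]
  rw [Real.negMulLog_mul]
  have := mul_le_mul_of_nonneg_left (log_two_sub_binEntropy_mul_le hw hc) (mul_nonneg hM hm)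
  nlinarith [this]

/-- For the channel with rows `t` and `t ∘ σ` and unnormalised input weights `(a, b)`, the mutual
information (in nats) between input and output. -/
def symmInfo [Fintype α] (t : α → ℝ) (σ : Equiv.Perm α) (a b : ℝ) : ℝ :=
  ∑ x, Real.negMulLog (a * t x + b * t (σ x)) - (a + b) * ∑ x, Real.negMulLog (t x)
    - Real.negMulLog (a + b)

theorem sum_add_comp_perm [Fintype α] (σ : Equiv.Perm α) (f : α → ℝ) :
    ∑ x, (f x + f (σ x)) = 2 * ∑ x, f x := by
  rw [Finset.sum_add_distrib, Equiv.sum_comp σ f, two_mul]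

theorem symmInfo_mul_log_two_le [Fintype α] {t : α → ℝ} (ht : ∀ x, 0 ≤ t x) (ht1 : ∑ x, t x = 1)
    {σ : Equiv.Perm α} (hσ : ∀ x, σ (σ x) = x) {a b : ℝ} (ha : 0 ≤ a) (hb : 0 ≤ b) :
    symmInfo t σ a b * Real.log 2 ≤
      (Real.negMulLog a + Real.negMulLog b - Real.negMulLog (a + b)) *
        symmInfo t σ (1 / 2) (1 / 2) := by
  have key := Finset.sum_le_sum fun x (_ : x ∈ Finset.univ) =>
    negMulLog_mix_le ha hb (ht x) (ht (σ x))
  have e1 := sum_add_comp_perm σ fun x => Real.negMulLog (a * t x + b * t (σ x))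
  have e2 := sum_add_comp_perm σ fun x => Real.negMulLog (1 / 2 * t x + 1 / 2 * t (σ x))
  have e3 := sum_add_comp_perm σ fun x => Real.negMulLog (t x)
  have e4 := sum_add_comp_perm σ t
  simp only [hσ] at e1 e2
  rw [← Finset.sum_mul, ← Finset.mul_sum] at key
  simp only [Finset.sum_sub_distrib, ← Finset.mul_sum, ← Finset.sum_mul, e1, e2, e3, e4, ht1]
    at key
  rw [symmInfo, symmInfo, show (1 / 2 + 1 / 2 : ℝ) = 1 by norm_num, Real.negMulLog_one]
  linarith

theorem symmInfo_half_nonneg [Fintype α] {t : α → ℝ} {σ : Equiv.Perm α} (ht : ∀ x, 0 ≤ t x) :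
    0 ≤ symmInfo t σ (1 / 2) (1 / 2) := by
  have key := Finset.sum_le_sum fun x (_ : x ∈ Finset.univ) =>
    Real.concaveOn_negMulLog.2 (ht x) (ht (σ x)) (by norm_num : (0 : ℝ) ≤ 1 / 2)
      (by norm_num : (0 : ℝ) ≤ 1 / 2) (by norm_num)
  simp only [smul_eq_mul, ← mul_add, ← Finset.mul_sum,
    sum_add_comp_perm σ fun x => Real.negMulLog (t x)] at key
  rw [symmInfo, show (1 / 2 + 1 / 2 : ℝ) = 1 by norm_num, Real.negMulLog_one]
  simp only [← mul_add]
  linarith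

theorem ent_eq_sum_negMulLog [Fintype α] (p : α → ℝ) :
    ent p = (∑ a, Real.negMulLog (p a)) / Real.log 2 := by
  rw [ent, Finset.sum_div]
  refine Finset.sum_congr rfl fun a _ => ?_
  rw [Real.negMulLog, Real.logb]
  ring

theorem mi_jointXZ [Fintype α] [Fintype β] [Fintype γ] (p : α × β → ℝ) {q : β → γ → ℝ}
    (hq : IsChannel q) :
    mi (jointXZ p q) = (∑ x, Real.negMulLog (margA p x) +
      ∑ z, (Real.negMulLog (∑ y, margB p y * q y z) -
        ∑ x, Real.negMulLog (∑ y, p (x, y) * q y z))) / Real.log 2 := by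
  have hA : margA (jointXZ p q) = margA p := by
    funext x
    simp only [margA, jointXZ]
    rw [Finset.sum_comm]
    simp [← Finset.mul_sum, hq.2]
  have hB : margB (jointXZ p q) = fun z => ∑ y, margB p y * q y z := by
    funext z
    simp only [margB, jointXZ]
    rw [Finset.sum_comm]
    simp [← Finset.sum_mul]
  rw [mi, hA, hB]
  simp only [ent_eq_sum_negMulLog, Finset.sum_sub_distrib, Fintype.sum_prod_type_right, jointXZ]
  ring

theorem mi_jointYZ [Fintype α] [Fintype β] [Fintype γ] (p : α × β → ℝ) {q : β → γ → ℝ}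
    (hq : IsChannel q) :
    mi (jointYZ p q) = ent (margB p) +
      (∑ z, (Real.negMulLog (∑ y, margB p y * q y z) -
        ∑ y, Real.negMulLog (margB p y * q y z))) / Real.log 2 := by
  have hA : margA (jointYZ p q) = margB p := by
    funext y
    simp [margA, jointYZ, ← Finset.mul_sum, hq.2]
  have hB : margB (jointYZ p q) = fun z => ∑ y, margB p y * q y z := rfl
  rw [mi, hA, hB]
  simp only [ent_eq_sum_negMulLog, Finset.sum_sub_distrib, Fintype.sum_prod_type_right, jointYZ]
  ring

/-- The symbol-erasing filter: `Y` is revealed with probability `l` and erased otherwise. -/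
def erasure (l : ℝ) : Bool → Fin 3 → ℝ
  | true => ![l, 0, 1 - l]
  | false => ![0, l, 1 - l]

theorem isChannel_erasure {l : ℝ} (h0 : 0 ≤ l) (h1 : l ≤ 1) : IsChannel (erasure l) := by
  refine ⟨fun y z => ?_, fun y => ?_⟩
  · cases y <;> fin_cases z <;> simp [erasure, h0, h1]
  · cases y <;> simp [erasure, Fin.sum_univ_three]

theorem sum_negMulLog_mul [Fintype α] (f : α → ℝ) (l : ℝ) :
    ∑ x, Real.negMulLog (f x * l) =
      l * ∑ x, Real.negMulLog (f x) + (∑ x, f x) * Real.negMulLog l := by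
  simp only [Real.negMulLog_mul, Finset.sum_add_distrib, Finset.mul_sum, Finset.sum_mul]

theorem sum_margA_s14 [Fintype α] [Fintype β] (p : α × β → ℝ) : ∑ x, margA p x = ∑ x, p x :=
  (Fintype.sum_prod_type p).symm

theorem sum_margB_s14 [Fintype α] [Fintype β] (p : α × β → ℝ) : ∑ y, margB p y = ∑ x, p x :=
  (Fintype.sum_prod_type_right p).symm

theorem mi_jointXZ_erasure [Fintype α] {p : α × Bool → ℝ} (hp : IsPMF p) {l : ℝ} (h0 : 0 ≤ l)
    (h1 : l ≤ 1) : mi (jointXZ p (erasure l)) = l * mi p := by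
  have hA : ∀ x, p (x, true) * (1 - l) + p (x, false) * (1 - l) = margA p x * (1 - l) :=
    fun x => by rw [margA, Fintype.sum_bool]; ring
  have hB : margB p true * (1 - l) + margB p false * (1 - l) = 1 - l := by
    rw [← add_mul, ← Fintype.sum_bool, sum_margB_s14, hp.2, one_mul]
  rw [mi_jointXZ p (isChannel_erasure h0 h1), mi]
  simp only [Fin.sum_univ_three, Fintype.sum_bool, erasure, Matrix.cons_val, mul_zero, add_zero,
    zero_add, hA, hB, sum_negMulLog_mul, sum_margA_s14, hp.2, ent_eq_sum_negMulLog,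
    Fintype.sum_prod_type_right]
  simp only [Real.negMulLog_mul, margB]
  ring

theorem mi_jointYZ_erasure [Fintype α] {p : α × Bool → ℝ} (hp : IsPMF p) {l : ℝ} (h0 : 0 ≤ l)
    (h1 : l ≤ 1) : mi (jointYZ p (erasure l)) = l * ent (margB p) := by
  have hB : margB p true + margB p false = 1 := by
    rw [← Fintype.sum_bool, sum_margB_s14, hp.2]
  have hB' : margB p true * (1 - l) + margB p false * (1 - l) = 1 - l := by
    rw [← add_mul, hB, one_mul]
  rw [mi_jointYZ p (isChannel_erasure h0 h1)]
  simp only [Fin.sum_univ_three, Fintype.sum_bool, erasure, Matrix.cons_val, mul_zero, add_zero,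
    zero_add, hB', ent_eq_sum_negMulLog, Real.negMulLog_mul, Real.negMulLog_zero]
  have e : margB p true = 1 - margB p false := by linarith
  rw [e]
  ring

/-- Negation of the alphabet `{0, ±1, …, ±k}` as a permutation. -/
def negPerm (k : ℕ) : Equiv.Perm (Xk k) :=
  Function.Involutive.toPerm negXk fun x => Subtype.ext (neg_neg x.1)

theorem negPerm_negPerm {k : ℕ} (x : Xk k) : negPerm k (negPerm k x) = x :=
  Subtype.ext (neg_neg x.1)

section BISO

variable {k : ℕ} {p : Xk k × Bool → ℝ}

/-- The output distribution of the channel `P_{X|Y}` given the input `1`. -/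
def rowTrue (p : Xk k × Bool → ℝ) (x : Xk k) : ℝ := p (x, true) / margB p true

theorem IsBISO.div_false_eq (h : IsBISO p) (x : Xk k) :
    p (x, false) / margB p false = rowTrue p (negPerm k x) := by
  have := h (negPerm k x)
  rw [show negXk (negPerm k x) = x from negPerm_negPerm x] at this
  exact this.symm

theorem sum_rowTrue (h0 : 0 < margB p true) : ∑ x, rowTrue p x = 1 := by
  simp only [rowTrue, ← Finset.sum_div]
  exact div_self h0.ne'

theorem mi_channel_eq_symmInfo (h : IsBISO p) (h0 : 0 < margB p true) {w : Bool → ℝ}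
    (hw : ∑ b, w b = 1) :
    mi (fun xb : Xk k × Bool => (p (xb.1, xb.2) / margB p xb.2) * w xb.2) =
      symmInfo (rowTrue p) (negPerm k) (w true) (w false) / Real.log 2 := by
  have ht := sum_rowTrue h0
  have hs : ∀ f : Xk k → ℝ, ∑ x, f (negPerm k x) = ∑ x, f x := Equiv.sum_comp (negPerm k)
  have hrow : ∀ x, p (x, true) / margB p true = rowTrue p x := fun _ => rfl
  have hA : margA (fun xb : Xk k × Bool => (p (xb.1, xb.2) / margB p xb.2) * w xb.2) =
      fun x => w true * rowTrue p x + w false * rowTrue p (negPerm k x) := by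
    funext x
    simp only [margA, Fintype.sum_bool, h.div_false_eq, hrow]
    ring
  have hB : margB (fun xb : Xk k × Bool => (p (xb.1, xb.2) / margB p xb.2) * w xb.2) = w := by
    funext b
    change ∑ x, p (x, b) / margB p b * w b = w b
    rw [← Finset.sum_mul]
    cases b
    · simp only [h.div_false_eq, hs, ht, one_mul]
    · simp only [hrow, ht, one_mul]
  rw [mi, hA, hB]
  rw [Fintype.sum_bool] at hw
  simp only [ent_eq_sum_negMulLog, Fintype.sum_prod_type_right, Fintype.sum_bool, h.div_false_eq,
    hrow, sum_negMulLog_mul, symmInfo, hw, Real.negMulLog_one, ht,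
    hs fun x => Real.negMulLog (rowTrue p x), hs (rowTrue p)]
  linear_combination (-(∑ x, Real.negMulLog (rowTrue p x)) / Real.log 2) * hw

theorem sum_margB_eq_one (hp : IsPMF p) : margB p true + margB p false = 1 := by
  rw [← Fintype.sum_bool, sum_margB_s14, hp.2]

theorem rowTrue_nonneg (hp : IsPMF p) (h0 : 0 < margB p true) (x : Xk k) : 0 ≤ rowTrue p x :=
  div_nonneg (hp.1 _) h0.le

theorem capacity_eq (hp : IsPMF p) (h : IsBISO p) (h0 : 0 < margB p true) :
    capacity p = symmInfo (rowTrue p) (negPerm k) (1 / 2) (1 / 2) / Real.log 2 := by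
  have hlog : 0 < Real.log 2 := Real.log_pos one_lt_two
  refine IsGreatest.csSup_eq ⟨⟨fun _ => 1 / 2, fun _ => by norm_num, by norm_num, ?_⟩, ?_⟩
  · exact (mi_channel_eq_symmInfo h h0 (w := fun _ => 1 / 2) (by norm_num)).symm
  · rintro r ⟨w, hw, hw1, rfl⟩
    rw [mi_channel_eq_symmInfo h h0 hw1]
    rw [Fintype.sum_bool] at hw1
    refine div_le_div_of_nonneg_right ?_ hlog.le
    have key := symmInfo_mul_log_two_le (rowTrue_nonneg hp h0) (sum_rowTrue h0)
      (σ := negPerm k) negPerm_negPerm (hw true) (hw false)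
    have hwf : w false = 1 - w true := by linarith
    rw [hw1, Real.negMulLog_one, sub_zero, hwf,
      ← Real.binEntropy_eq_negMulLog_add_negMulLog_one_sub] at key
    have := mul_le_mul_of_nonneg_right (Real.binEntropy_le_log_two (p := w true))
      (symmInfo_half_nonneg (σ := negPerm k) (rowTrue_nonneg hp h0))
    rw [hwf]
    exact le_of_mul_le_mul_right (by linarith) hlog

theorem mi_sub_mi_jointXZ_le (hp : IsPMF p) (h : IsBISO p) (h0 : 0 < margB p true)
    (h1 : margB p true < 1) {n : ℕ} {q : Bool → Fin n → ℝ} (hq : IsChannel q) :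
    mi p - mi (jointXZ p q) ≤ capacity p * (ent (margB p) - mi (jointYZ p q)) := by
  have hlog : 0 < Real.log 2 := Real.log_pos one_lt_two
  have hB := sum_margB_eq_one hp
  have h0' : 0 < margB p false := by linarith
  have hmix : ∀ x z, ∑ y, p (x, y) * q y z =
      margB p true * q true z * rowTrue p x +
        margB p false * q false z * rowTrue p (negPerm k x) := by
    intro x z
    rw [← h.div_false_eq, rowTrue, Fintype.sum_bool]
    field_simp
  have hmi : mi p = symmInfo (rowTrue p) (negPerm k) (margB p true) (margB p false) /
      Real.log 2 := by
    rw [← mi_channel_eq_symmInfo h h0 (by rw [Fintype.sum_bool, hB])]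
    congr 1
    funext ⟨x, b⟩
    cases b
    · exact (div_mul_cancel₀ _ h0'.ne').symm
    · exact (div_mul_cancel₀ _ h0.ne').symm
  have hmA : ∀ x, margA p x = margB p true * rowTrue p x +
      margB p false * rowTrue p (negPerm k x) := by
    intro x
    rw [← h.div_false_eq, rowTrue, margA, Fintype.sum_bool]
    field_simp
  have hsum : ∑ z, (margB p true * q true z + margB p false * q false z) = 1 := by
    rw [Finset.sum_add_distrib, ← Finset.mul_sum, ← Finset.mul_sum, hq.2, hq.2]
    linarith
  have key := Finset.sum_le_sum fun z (_ : z ∈ Finset.univ) =>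
    symmInfo_mul_log_two_le (rowTrue_nonneg hp h0) (sum_rowTrue h0) (σ := negPerm k)
      negPerm_negPerm (mul_nonneg h0.le (hq.1 true z)) (mul_nonneg h0'.le (hq.1 false z))
  rw [← Finset.sum_mul, ← Finset.sum_mul] at key
  have hL : mi p - mi (jointXZ p q) = (∑ z, symmInfo (rowTrue p) (negPerm k)
      (margB p true * q true z) (margB p false * q false z)) / Real.log 2 := by
    rw [hmi, mi_jointXZ p hq]
    simp only [symmInfo, hmix, hmA, Finset.sum_sub_distrib, ← Finset.sum_mul, hsum, hB,
      Real.negMulLog_one, Fintype.sum_bool]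
    ring
  have hR : ent (margB p) - mi (jointYZ p q) = (∑ z, (Real.negMulLog (margB p true * q true z) +
      Real.negMulLog (margB p false * q false z) -
      Real.negMulLog (margB p true * q true z + margB p false * q false z))) / Real.log 2 := by
    rw [mi_jointYZ p hq]
    simp only [Fintype.sum_bool, Finset.sum_sub_distrib]
    ring
  rw [hL, hR, capacity_eq hp h h0, div_mul_div_comm, div_le_div_iff₀ hlog (by positivity)]
  nlinarith

end BISO

theorem negMulLog_add_le {a b : ℝ} (ha : 0 ≤ a) (hb : 0 ≤ b) :
    Real.negMulLog (a + b) ≤ Real.negMulLog a + Real.negMulLog b := by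
  obtain ⟨m, w, hm, hw, rfl, rfl⟩ := exists_eq_mul_of_nonneg ha hb
  rw [negMulLog_mul_add_negMulLog_mul_one_sub, ← mul_add, add_sub_cancel, mul_one]
  have := mul_nonneg hm (Real.binEntropy_nonneg hw.1 hw.2)
  linarith

theorem mi_jointYZ_le_ent [Fintype α] [Fintype γ] {p : α × Bool → ℝ} (hp : IsPMF p)
    {q : Bool → γ → ℝ} (hq : IsChannel q) : mi (jointYZ p q) ≤ ent (margB p) := by
  rw [mi_jointYZ p hq, add_le_iff_nonpos_right]
  refine div_nonpos_of_nonpos_of_nonneg (Finset.sum_nonpos fun z _ => ?_)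
    (Real.log_pos one_lt_two).le
  have hB : ∀ y, 0 ≤ margB p y := fun y => Finset.sum_nonneg fun x _ => hp.1 _
  rw [Fintype.sum_bool, Fintype.sum_bool, sub_nonpos]
  exact negMulLog_add_le (mul_nonneg (hB _) (hq.1 _ _)) (mul_nonneg (hB _) (hq.1 _ _))

/-- If the reverse channel `P_{X|Y}` is BISO (with `Y` binary,
non-degenerate, and `X, Y` not independent), then for every `ε ∈ [0, I(X;Y)]`,
`ε·H(Y)/I(X;Y) ≤ g_ε(X;Y) ≤ H(Y) − (I(X;Y) − ε)/C(P_{X|Y})`. -/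
theorem stmt14 {k : ℕ} (p : Xk k × Bool → ℝ) (hp : IsPMF p)
    (h0 : 0 < margB p true) (h1 : margB p true < 1)
    (hdep : ¬ ∀ x y, p (x, y) = margA p x * margB p y)
    (hBISO : IsBISO p) :
    ∀ ε : ℝ, 0 ≤ ε → ε ≤ mi p →
      ε * ent (margB p) / mi p ≤ g p ε ∧
      g p ε ≤ ent (margB p) - (mi p - ε) / capacity p := by
  intro ε hε hεmi
  have hl0 : 0 ≤ ε / mi p := div_nonneg hε (hε.trans hεmi)
  have hl1 : ε / mi p ≤ 1 := div_le_one_of_le₀ hεmi (hε.trans hεmi)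
  have hmem : ε * ent (margB p) / mi p ∈ gSet p ε := by
    refine ⟨3, erasure (ε / mi p), isChannel_erasure hl0 hl1, ?_, ?_⟩
    · rw [mi_jointXZ_erasure hp hl0 hl1]
      rcases (hε.trans hεmi).eq_or_lt with h | h
      · rwa [← h, mul_zero]
      · exact (div_mul_cancel₀ ε h.ne').le
    · rw [mi_jointYZ_erasure hp hl0 hl1]
      ring
  refine ⟨le_csSup ⟨ent (margB p), ?_⟩ hmem, csSup_le ⟨_, hmem⟩ ?_⟩
  · rintro r ⟨n, q, hq, -, rfl⟩
    exact mi_jointYZ_le_ent hp hq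
  · rintro r ⟨n, q, hq, hqε, rfl⟩
    have hC : 0 ≤ capacity p := by
      rw [capacity_eq hp hBISO h0]
      exact div_nonneg (symmInfo_half_nonneg (rowTrue_nonneg hp h0))
        (Real.log_pos one_lt_two).le
    rw [le_sub_comm]
    refine div_le_of_le_mul₀ hC (sub_nonneg.2 (mi_jointYZ_le_ent hp hq)) ?_
    rw [mul_comm]
    exact (sub_le_sub_left hqε _).trans (mi_sub_mi_jointXZ_le hp hBISO h0 h1 hq)

end RatePrivacy
end
end
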